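/- For every t > 0, the second factorial moment of the GCP at Brownian sojourn time is ∑_{n=0}^∞ n(n−1) p⁺(n,t) = (3/8)(c₁ t)² + (t/2) ∑_{j=1}^k j(j−1) λ_j, and consequently its variance is ∑_{n=0}^∞ n² p⁺(n,t) − (∑_{n=0}^∞ n p⁺(n,t))² = (1/8)(c₁ t)² + (1/2) c₂ t. -/

import Mathlib

noncomputable section
open MeasureTheory Real Finset

/-- The set Ω(k,n) of k-tuples (x₁,…,x_k) of nonnegative integers with
x₁ + 2x₂ + ⋯ + k x_k = n. -/
def Omega (k n : ℕ) : Finset (Fin k → ℕ) :=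
  (Fintype.piFinset fun _ : Fin k => Finset.range (n + 1)).filter
    (fun x => ∑ j, (j.val + 1) * x j = n)

/-- The state probabilities of the generalized counting process. -/
def gcp (k : ℕ) (l : Fin k → ℝ) (n : ℕ) (t : ℝ) : ℝ :=
  ∑ x ∈ Omega k n, ∏ j, ((l j * t) ^ (x j) / (Nat.factorial (x j) : ℝ) *
    Real.exp (-(l j * t)))

/-- State probabilities of the GCP at Brownian sojourn time. -/
def pplus (k : ℕ) (l : Fin k → ℝ) (n : ℕ) (t : ℝ) : ℝ :=
  ∫ x in (0 : ℝ)..t, gcp k l n x * (1 / (Real.pi * Real.sqrt (x * (t - x))))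

def po (a : ℝ) (n : ℕ) : ℝ := a ^ n / (Nat.factorial n : ℝ) * Real.exp (-a)

lemma po_nonneg {a : ℝ} (ha : 0 ≤ a) (n : ℕ) : 0 ≤ po a n := by
  unfold po; positivity

lemma po_sum0 (a : ℝ) : HasSum (po a) 1 := by
  have h := (NormedSpace.expSeries_div_hasSum_exp a).mul_right (Real.exp (-a))
  rw [← Real.exp_eq_exp_ℝ, ← Real.exp_add, add_neg_cancel, Real.exp_zero] at h
  exact h

lemma po_succ (a : ℝ) (n : ℕ) : ((n + 1 : ℕ) : ℝ) * po a (n + 1) = a * po a n := by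
  unfold po
  rw [Nat.factorial_succ]
  have : (Nat.factorial n : ℝ) ≠ 0 := by positivity
  push_cast
  have : (n : ℝ) + 1 ≠ 0 := by positivity
  field_simp
  ring

lemma po_sum1 (a : ℝ) : HasSum (fun n : ℕ => (n : ℝ) * po a n) a := by
  rw [← hasSum_nat_add_iff' 1]
  simp only [po_succ]
  simpa using (po_sum0 a).mul_left a

lemma po_sum2 (a : ℝ) : HasSum (fun n : ℕ => (n : ℝ) ^ 2 * po a n) (a ^ 2 + a) := by
  rw [← hasSum_nat_add_iff' 1]
  have h := ((po_sum1 a).mul_left a).add ((po_sum0 a).mul_left a)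
  convert! h using 1
  · ext n
    rw [sq, mul_assoc, po_succ]; push_cast; ring
  · simp; ring

lemma multi (k : ℕ) : ∀ (a m : Fin k → ℝ), (∀ j, 0 ≤ a j) → (∀ j, 0 ≤ m j) →
    HasSum (fun x : Fin k → ℕ => ∏ j, po (m j) (x j)) 1 ∧
    HasSum (fun x : Fin k → ℕ => (∑ j, a j * x j) * ∏ j, po (m j) (x j)) (∑ j, a j * m j) ∧
    HasSum (fun x : Fin k → ℕ => (∑ j, a j * x j) ^ 2 * ∏ j, po (m j) (x j))
      ((∑ j, a j * m j) ^ 2 + ∑ j, a j ^ 2 * m j) := by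
  induction k with
  | zero =>
    intro a m _ _
    refine ⟨?_, ?_, ?_⟩
    · simpa using hasSum_unique (fun x : Fin 0 → ℕ => (1 : ℝ))
    · simpa using (hasSum_zero : HasSum (fun x : Fin 0 → ℕ => (0 : ℝ)) 0)
    · simpa using (hasSum_zero : HasSum (fun x : Fin 0 → ℕ => (0 : ℝ)) 0)
  | succ k ih =>
    intro a m ha hm
    obtain ⟨h0, h1, h2⟩ := ih (fun j => a j.succ) (fun j => m j.succ) (fun j => ha _) (fun j => hm _)
    have mulc : ∀ {f : ℕ → ℝ} {g : (Fin k → ℕ) → ℝ} {s t : ℝ}, HasSum f s → HasSum g t →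
        (∀ n, 0 ≤ f n) → (∀ n, 0 ≤ g n) →
        HasSum (fun x : ℕ × (Fin k → ℕ) => f x.1 * g x.2) (s * t) := by
      intro f g s t hf hg hf' hg'
      exact hf.mul hg (hf.summable.mul_of_nonneg hg.summable hf' hg')
    have p0 := po_nonneg (hm 0)
    have q0 : ∀ x : Fin k → ℕ, 0 ≤ ∏ j, po (m j.succ) (x j) := fun x =>
      Finset.prod_nonneg fun j _ => po_nonneg (hm _) _
    have S0 : ∀ x : Fin k → ℕ, 0 ≤ ∑ j, a j.succ * x j := fun x =>
      Finset.sum_nonneg fun j _ => mul_nonneg (ha _) (by positivity)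
    have p1 : ∀ n : ℕ, 0 ≤ (n : ℝ) * po (m 0) n := fun n => mul_nonneg (by positivity) (p0 n)
    have p2 : ∀ n : ℕ, 0 ≤ (n : ℝ) ^ 2 * po (m 0) n := fun n => mul_nonneg (by positivity) (p0 n)
    have q1 := fun x => mul_nonneg (S0 x) (q0 x)
    have q2 := fun x => mul_nonneg (pow_nonneg (S0 x) 2) (q0 x)
    have A00 := mulc (po_sum0 (m 0)) h0 p0 q0
    have A01 := mulc (po_sum0 (m 0)) h1 p0 q1
    have A02 := mulc (po_sum0 (m 0)) h2 p0 q2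
    have A10 := mulc (po_sum1 (m 0)) h0 p1 q0
    have A11 := mulc (po_sum1 (m 0)) h1 p1 q1
    have A20 := mulc (po_sum2 (m 0)) h0 p2 q0
    refine ⟨?_, ?_, ?_⟩
    · rw [← (Fin.consEquiv (fun _ : Fin (k + 1) => ℕ)).hasSum_iff]
      convert! A00 using 1
      · ext x; simp [Fin.consEquiv, Fin.prod_univ_succ]
      · simp
    · rw [← (Fin.consEquiv (fun _ : Fin (k + 1) => ℕ)).hasSum_iff]
      convert! (A10.mul_left (a 0)).add A01 using 1
      · ext x; simp [Fin.consEquiv, Fin.prod_univ_succ, Fin.sum_univ_succ]; ring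
      · simp [Fin.sum_univ_succ]
    · rw [← (Fin.consEquiv (fun _ : Fin (k + 1) => ℕ)).hasSum_iff]
      convert! ((A20.mul_left (a 0 ^ 2)).add (A11.mul_left (2 * a 0))).add A02 using 1
      · ext x; simp [Fin.consEquiv, Fin.prod_univ_succ, Fin.sum_univ_succ]; ring
      · simp [Fin.sum_univ_succ]; ring

lemma mem_Omega (k n : ℕ) (x : Fin k → ℕ) : x ∈ Omega k n ↔ ∑ j, (j.val + 1) * x j = n := by
  unfold Omega
  simp only [Finset.mem_filter, Fintype.mem_piFinset, Finset.mem_range, and_iff_right_iff_imp]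
  intro h j
  have h1 : (j.val + 1) * x j ≤ ∑ j, (j.val + 1) * x j :=
    Finset.single_le_sum (f := fun j : Fin k => (j.val + 1) * x j)
      (fun _ _ => Nat.zero_le _) (Finset.mem_univ j)
  nlinarith [Nat.zero_le (j.val * x j)]

lemma group (k : ℕ) (l : Fin k → ℝ) (t : ℝ) (φ : ℝ → ℝ) (s : ℝ)
    (h : HasSum (fun x : Fin k → ℕ =>
      φ (∑ j, (j.val + 1 : ℝ) * x j) * ∏ j, po (l j * t) (x j)) s) :
    HasSum (fun n : ℕ => φ n * gcp k l n t) s := by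
  have h' := h.tsum_fiberwise (fun x : Fin k → ℕ => ∑ j, (j.val + 1) * x j)
  convert! h' using 1
  ext n
  have e : ((fun x : Fin k → ℕ => ∑ j, (j.val + 1) * x j) ⁻¹' {n}) = ↑(Omega k n) := by
    ext x; simp [mem_Omega]
  rw [e, Finset.tsum_subtype' (Omega k n) (fun x : Fin k → ℕ =>
      φ (∑ j, (j.val + 1 : ℝ) * x j) * ∏ j, po (l j * t) (x j)), gcp, Finset.mul_sum]
  refine Finset.sum_congr rfl fun x hx => ?_
  rw [mem_Omega] at hx
  rw [← hx]
  push_cast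
  rfl

/-- arcsine weight -/
def wt (t x : ℝ) : ℝ := 1 / (Real.pi * Real.sqrt (x * (t - x)))

lemma wt_nonneg (t x : ℝ) : 0 ≤ wt t x := by
  unfold wt; positivity

lemma deriv_asin {t : ℝ} {x : ℝ} (hx : x ∈ Set.Ioo 0 t) :
    HasDerivAt (fun x => Real.arcsin (2 * x / t - 1) / Real.pi) (wt t x) x := by
  obtain ⟨h0, h1⟩ := hx
  have ht : 0 < t := h0.trans h1
  have i : HasDerivAt (fun x : ℝ => 2 * x / t - 1) (2 / t) x := by
    simpa using (((hasDerivAt_id x).const_mul 2).div_const t).sub_const 1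
  have n1 : 2 * x / t - 1 ≠ -1 := by
    have : 0 < 2 * x / t := by positivity
    linarith
  have n2 : 2 * x / t - 1 ≠ 1 := by
    have : 2 * x / t < 2 := by rw [div_lt_iff₀ ht]; linarith
    linarith
  have d := ((Real.hasDerivAt_arcsin n1 n2).comp x i).div_const Real.pi
  convert! d using 1
  have e : 1 - (2 * x / t - 1) ^ 2 = (x * (t - x)) * (2 / t) ^ 2 := by
    field_simp; ring
  have hp : 0 < x * (t - x) := mul_pos h0 (by linarith)
  rw [e, Real.sqrt_mul hp.le, Real.sqrt_sq (by positivity), wt]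
  have := Real.sqrt_pos.2 hp
  field_simp

lemma deriv_sq {t : ℝ} {x : ℝ} (hx : x ∈ Set.Ioo 0 t) :
    HasDerivAt (fun x => Real.sqrt (x * (t - x)) / Real.pi) ((t / 2 - x) * wt t x) x := by
  obtain ⟨h0, h1⟩ := hx
  have hp : 0 < x * (t - x) := mul_pos h0 (by linarith)
  have i : HasDerivAt (fun x : ℝ => x * (t - x)) (t - 2 * x) x := by
    have := (hasDerivAt_id x).mul ((hasDerivAt_id x).const_sub t)
    convert! this using 1
    simp; ring
  have d := (i.sqrt hp.ne').div_const Real.pi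
  convert! d using 1
  rw [wt]
  have := Real.sqrt_pos.2 hp
  field_simp

lemma wt_int {t : ℝ} (ht : 0 < t) : IntervalIntegrable (wt t) volume 0 t := by
  apply intervalIntegral.intervalIntegrable_deriv_of_nonneg
    (g := fun x => Real.arcsin (2 * x / t - 1) / Real.pi)
  · exact (((Real.continuous_arcsin.comp (by fun_prop)).div_const _)).continuousOn
  · intro x hx
    rw [min_eq_left ht.le, max_eq_right ht.le] at hx
    exact deriv_asin hx
  · intro x _; exact wt_nonneg t x

lemma pw_int {t : ℝ} (ht : 0 < t) (a b : ℝ) :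
    IntervalIntegrable (fun x => (a * x + b * x ^ 2) * wt t x) volume 0 t :=
  (wt_int ht).continuousOn_mul (by fun_prop)

lemma pw_integral {t : ℝ} (ht : 0 < t) (a b : ℝ) :
    ∫ x in (0 : ℝ)..t, (a * x + b * x ^ 2) * wt t x = a * (t / 2) + b * (3 / 8 * t ^ 2) := by
  have key := intervalIntegral.integral_eq_sub_of_hasDerivAt_of_le (a := 0) (b := t) ht.le
    (f := fun x => (a * (t / 2) + b * (3 / 8 * t ^ 2)) * (Real.arcsin (2 * x / t - 1) / Real.pi)
      - ((a + b * (3 / 4 * t)) + b / 2 * x) * (Real.sqrt (x * (t - x)) / Real.pi))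
    (f' := fun x => (a * x + b * x ^ 2) * wt t x) ?_ ?_ (pw_int ht a b)
  · rw [key]
    have : 2 * t / t - 1 = 1 := by field_simp; norm_num
    simp only [this]
    simp
    field_simp
    ring
  · apply Continuous.continuousOn
    have : Continuous (fun x => Real.arcsin (2 * x / t - 1)) :=
      Real.continuous_arcsin.comp (by fun_prop)
    fun_prop
  · intro x hx
    have i : HasDerivAt (fun x : ℝ => (a + b * (3 / 4 * t)) + b / 2 * x) (b / 2) x := by
      simpa using ((hasDerivAt_id x).const_mul (b / 2)).const_add (a + b * (3 / 4 * t))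
    have d := ((deriv_asin hx).const_mul (a * (t / 2) + b * (3 / 8 * t ^ 2))).sub
      (i.mul (deriv_sq hx))
    convert! d using 1
    have hp : 0 < x * (t - x) := mul_pos hx.1 (by linarith [hx.2])
    have hs := Real.sqrt_pos.2 hp
    have e : Real.sqrt (x * (t - x)) / Real.pi = (x * (t - x)) * wt t x := by
      rw [wt]
      field_simp
      exact Real.sq_sqrt hp.le
    rw [e]
    ring

lemma gcp_nonneg {k : ℕ} {l : Fin k → ℝ} (hl : ∀ j, 0 < l j) (n : ℕ) {x : ℝ} (hx : 0 ≤ x) :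
    0 ≤ gcp k l n x :=
  Finset.sum_nonneg fun y _ => Finset.prod_nonneg fun j _ =>
    po_nonneg (mul_nonneg (hl j).le hx) _

lemma swap {k : ℕ} {l : Fin k → ℝ} (hl : ∀ j, 0 < l j) {t : ℝ} (ht : 0 < t)
    (φ : ℕ → ℝ) (hφ : ∀ n, 0 ≤ φ n) (a b : ℝ)
    (h : ∀ x, 0 ≤ x → HasSum (fun n : ℕ => φ n * gcp k l n x) (a * x + b * x ^ 2)) :
    HasSum (fun n : ℕ => φ n * pplus k l n t) (a * (t / 2) + b * (3 / 8 * t ^ 2)) := by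
  rw [← pw_integral ht a b]
  have hs : ∀ x ∈ Set.uIoc 0 t,
      HasSum (fun n : ℕ => φ n * gcp k l n x * wt t x) ((a * x + b * x ^ 2) * wt t x) := by
    intro x hx
    rw [Set.uIoc_of_le ht.le] at hx
    exact (h x hx.1.le).mul_right _
  have key := intervalIntegral.hasSum_integral_of_dominated_convergence (μ := volume)
    (a := 0) (b := t)
    (F := fun n x => φ n * gcp k l n x * wt t x)
    (f := fun x => (a * x + b * x ^ 2) * wt t x)
    (fun n x => φ n * gcp k l n x * wt t x) ?_ ?_ ?_ ?_ ?_
  · convert! key using 1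
    ext n
    rw [pplus, ← intervalIntegral.integral_const_mul]
    simp only [mul_assoc, wt]
  · intro n
    apply Measurable.aestronglyMeasurable
    unfold gcp wt
    fun_prop
  · intro n
    refine Filter.Eventually.of_forall fun x hx => ?_
    rw [Set.uIoc_of_le ht.le] at hx
    rw [Real.norm_of_nonneg]
    exact mul_nonneg (mul_nonneg (hφ n) (gcp_nonneg hl n hx.1.le)) (wt_nonneg _ _)
  · exact Filter.Eventually.of_forall fun x hx => (hs x hx).summable
  · exact (pw_int ht a b).congr fun x hx => (hs x hx).tsum_eq.symm
  · exact Filter.Eventually.of_forall hs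

theorem gcp_sojourn_moments (k : ℕ) (hk : 1 ≤ k) (l : Fin k → ℝ) (hl : ∀ j, 0 < l j)
    (c₁ c₂ : ℝ) (hc₁ : c₁ = ∑ j, (j.val + 1 : ℝ) * l j)
    (hc₂ : c₂ = ∑ j, ((j.val + 1 : ℝ)) ^ 2 * l j)
    (t : ℝ) (ht : 0 < t) :
    (∑' n : ℕ, (n : ℝ) * ((n : ℝ) - 1) * pplus k l n t) =
      (3 / 8) * (c₁ * t) ^ 2 + (t / 2) * ∑ j, (j.val + 1 : ℝ) * ((j.val + 1 : ℝ) - 1) * l j ∧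
    (∑' n : ℕ, (n : ℝ) ^ 2 * pplus k l n t) - (∑' n : ℕ, (n : ℝ) * pplus k l n t) ^ 2 =
      (1 / 8) * (c₁ * t) ^ 2 + (1 / 2) * c₂ * t := by
  have e1 : ∀ x : ℝ, ∑ j : Fin k, (j.val + 1 : ℝ) * (l j * x) = c₁ * x := by
    intro x; rw [hc₁, Finset.sum_mul]; simp only [mul_assoc]
  have e2 : ∀ x : ℝ, ∑ j : Fin k, (j.val + 1 : ℝ) ^ 2 * (l j * x) = c₂ * x := by
    intro x; rw [hc₂, Finset.sum_mul]; simp only [mul_assoc]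
  have M1 := swap hl ht (fun n => (n : ℝ)) (fun n => by positivity) c₁ 0 (by
    intro x hx
    have := (multi k (fun j => (j.val + 1 : ℝ)) (fun j => l j * x) (fun j => by positivity)
      (fun j => mul_nonneg (hl j).le hx)).2.1
    rw [e1] at this
    simpa using group k l x (fun y => y) _ this)
  have M2 := swap hl ht (fun n => (n : ℝ) ^ 2) (fun n => by positivity) c₂ (c₁ ^ 2) (by
    intro x hx
    have := (multi k (fun j => (j.val + 1 : ℝ)) (fun j => l j * x) (fun j => by positivity)
      (fun j => mul_nonneg (hl j).le hx)).2.2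
    rw [e1, e2] at this
    convert! group k l x (fun y => y ^ 2) _ this using 1
    ring)
  constructor
  · have e3 : ∑ j : Fin k, (j.val + 1 : ℝ) * ((j.val + 1 : ℝ) - 1) * l j = c₂ - c₁ := by
      rw [hc₁, hc₂, ← Finset.sum_sub_distrib]
      exact Finset.sum_congr rfl fun j _ => by ring
    rw [e3]
    have D := (M2.sub M1).tsum_eq
    rw [show (3 / 8) * (c₁ * t) ^ 2 + (t / 2) * (c₂ - c₁) =
      c₂ * (t / 2) + c₁ ^ 2 * (3 / 8 * t ^ 2) - (c₁ * (t / 2) + 0 * (3 / 8 * t ^ 2)) by ring, ← D]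
    exact tsum_congr fun n => by ring
  · rw [M2.tsum_eq, M1.tsum_eq]
    ring
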